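/- Let α ∈ (0,1) be irrational with continued fraction partial quotients (a_n) and convergent denominators (q_n), and let i ≥ 1. Then the sets V_l for integers l ∈ [q_i, q_{i−1} + q_i) are pairwise disjoint, and for each integer b with 2 ≤ b ≤ a_{i+1}, the sets V_l for integers l ∈ [q_{i−1} + (b−1)·q_i, q_{i−1} + b·q_i) are pairwise disjoint. -/

import Mathlib

open MeasureTheory Filter Set

noncomputable def rot (α : ℝ) : ℝ → ℝ := fun x => Int.fract (x + α)

noncomputable def gaussMap (x : ℝ) : ℝ := Int.fract (1 / x)

/-- The `n`-th continued fraction partial quotient of `α` (for `n ≥ 1`). -/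
noncomputable def cfA (α : ℝ) (n : ℕ) : ℕ := ⌊1 / (gaussMap^[n - 1] α)⌋₊

/-- The denominators of the convergents. -/
noncomputable def cfQ (α : ℝ) : ℕ → ℕ
  | 0 => 1
  | 1 => cfA α 1
  | n + 2 => cfA α (n + 2) * cfQ α (n + 1) + cfQ α n

/-- The coding of the orbit of `x` under the rotation by `α`. -/
noncomputable def code (α x : ℝ) (i : ℕ) : ℕ :=
  if (rot α)^[i] x < α then 0 else 1

/-- The set of points of `[0,1)` that are undetermined at step `j`. -/
def undet (α : ℝ) (j : ℕ) : Set ℝ :=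
  {x ∈ Set.Ico (0:ℝ) 1 | ∃ y ∈ Set.Ico (0:ℝ) 1,
    (∀ i ≤ j, code α y i = code α x i) ∧ code α y (j + 1) ≠ code α x (j + 1)}


lemma rot_step {α x : ℝ} (hα : α ∈ Set.Ioo (0:ℝ) 1) (hx : x ∈ Set.Ico (0:ℝ) 1) :
    (x < 1 - α ∧ rot α x = x + α ∧ ¬ rot α x < α) ∨
    (1 - α ≤ x ∧ rot α x = x + α - 1 ∧ rot α x < α) := by
  obtain ⟨h0, h1⟩ := hα
  obtain ⟨h2, h3⟩ := hx
  by_cases h : x < 1 - α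
  · left
    have : rot α x = x + α := by
      unfold rot
      exact Int.fract_eq_self.2 ⟨by linarith, by linarith⟩
    exact ⟨h, this, by rw [this]; linarith⟩
  · right
    push Not at h
    have : rot α x = x + α - 1 := by
      unfold rot
      rw [← Int.fract_sub_one]
      exact Int.fract_eq_self.2 ⟨by linarith, by linarith⟩
    exact ⟨h, this, by rw [this]; linarith⟩

lemma rot_iter_mem {α x : ℝ} (hx : x ∈ Set.Ico (0:ℝ) 1) (i : ℕ) :
    (rot α)^[i] x ∈ Set.Ico (0:ℝ) 1 := by
  cases i with
  | zero => simpa using hx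
  | succ n =>
    rw [Function.iterate_succ_apply']
    exact ⟨Int.fract_nonneg _, Int.fract_lt_one _⟩

lemma code_iff {α x y : ℝ} (hα : α ∈ Set.Ioo (0:ℝ) 1) (hx : x ∈ Set.Ico (0:ℝ) 1)
    (hy : y ∈ Set.Ico (0:ℝ) 1) (i : ℕ) :
    code α y (i+1) = code α x (i+1) ↔ ((rot α)^[i] x < 1 - α ↔ (rot α)^[i] y < 1 - α) := by
  unfold code
  rw [Function.iterate_succ_apply', Function.iterate_succ_apply']
  rcases rot_step hα (rot_iter_mem (α := α) hx i) with ⟨a, b, c⟩ | ⟨a, b, c⟩ <;>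
  rcases rot_step hα (rot_iter_mem (α := α) hy i) with ⟨a', b', c'⟩ | ⟨a', b', c'⟩ <;>
  first
  | simp [a, c, a', c']; done
  | simp [not_lt.2 a, c, not_lt.2 a', c', -not_lt]

lemma same_K {α x y : ℝ} (hα : α ∈ Set.Ioo (0:ℝ) 1) (hx : x ∈ Set.Ico (0:ℝ) 1)
    (hy : y ∈ Set.Ico (0:ℝ) 1) (j : ℕ) (h : ∀ i ≤ j, code α y i = code α x i) :
    ∀ i ≤ j, ∃ K : ℤ, (rot α)^[i] x = x + i * α - K ∧ (rot α)^[i] y = y + i * α - K := by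
  intro i
  induction i with
  | zero => intro _; exact ⟨0, by simp, by simp⟩
  | succ i ih =>
    intro hi
    obtain ⟨K, h1, h2⟩ := ih (by omega)
    have h3 := (code_iff hα hx hy i).1 (h _ hi)
    rw [Function.iterate_succ_apply', Function.iterate_succ_apply']
    rcases rot_step hα (rot_iter_mem (α := α) hx i) with ⟨a, b, c⟩ | ⟨a, b, c⟩ <;>
    rcases rot_step hα (rot_iter_mem (α := α) hy i) with ⟨a', b', c'⟩ | ⟨a', b', c'⟩
    · exact ⟨K, by rw [b, h1]; push_cast; ring, by rw [b', h2]; push_cast; ring⟩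
    · have := h3.1 a; linarith
    · have := h3.2 a'; linarith
    · exact ⟨K+1, by rw [b, h1]; push_cast; ring, by rw [b', h2]; push_cast; ring⟩

lemma core {α x y w : ℝ} (hα : α ∈ Set.Ioo (0:ℝ) 1) (hx : x ∈ Set.Ico (0:ℝ) 1)
    (hy : y ∈ Set.Ico (0:ℝ) 1) (j : ℕ) (h : ∀ i ≤ j, code α y i = code α x i)
    (t : ℕ) (ht : 1 ≤ t) (htj : t ≤ j) (p : ℤ) (hw : t * α = p + (w - (1 - α)))
    (hu : (rot α)^[j] x < w) (hv : w ≤ (rot α)^[j] y) : False := by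
  obtain ⟨K, h1, h2⟩ := same_K hα hx hy j h j le_rfl
  obtain ⟨K', h1', h2'⟩ := same_K hα hx hy j h (j - t) (by omega)
  have h3 := (code_iff hα hx hy (j-t)).1 (h _ (by omega))
  have m1 := rot_iter_mem (α := α) hx (j-t)
  have m2 := rot_iter_mem (α := α) hy (j-t)
  rw [Nat.cast_sub htj] at h1' h2'
  set X := (rot α)^[j-t] x
  set Y := (rot α)^[j-t] y
  obtain ⟨h0, h01⟩ := hα
  obtain ⟨m1, _⟩ := m1
  obtain ⟨_, m2⟩ := m2
  have e1 : X < 1 - α + ((K - K' - p : ℤ) : ℝ) := by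
    push_cast; nlinarith
  have e2 : 1 - α + ((K - K' - p : ℤ) : ℝ) ≤ Y := by
    push_cast; nlinarith
  have n0 : K - K' - p = 0 := by
    have a1 : ((-1 : ℤ):ℝ) < ((K - K' - p : ℤ) : ℝ) := by
      rw [Int.cast_neg, Int.cast_one]; linarith
    have a2 : ((K - K' - p : ℤ) : ℝ) < ((1 : ℤ):ℝ) := by
      rw [Int.cast_one]; linarith
    have := Int.cast_lt.1 a1
    have := Int.cast_lt.1 a2
    omega
  rw [n0] at e1 e2
  simp only [Int.cast_zero, add_zero] at e1 e2
  have := h3.1 e1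
  linarith

lemma undet_loc {α x A B : ℝ} (hα : α ∈ Set.Ioo (0:ℝ) 1) (j s t : ℕ)
    (hs : 1 ≤ s) (hsj : s ≤ j) (ht : 1 ≤ t) (htj : t ≤ j) (p p' : ℤ)
    (hA : 0 < A) (hB : 0 < B)
    (ht' : t * α = p - A) (hs' : s * α = p' + B) (hx : x ∈ undet α j) :
    ∃ M : ℤ, -A ≤ x + (j + 1) * α - M ∧ x + (j + 1) * α - M < B := by
  obtain ⟨hx, y, hy, h, hne⟩ := hx
  obtain ⟨K, h1, h2⟩ := same_K hα hx hy j h j le_rfl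
  have h3 := (code_iff hα hx hy j).not.1 hne
  have h' : ∀ i ≤ j, code α x i = code α y i := fun i hi => (h i hi).symm
  refine ⟨K + 1, ?_⟩
  push_cast
  suffices 1 - α - A ≤ (rot α)^[j] x ∧ (rot α)^[j] x < 1 - α + B by
    constructor <;> linarith [this.1, this.2]
  by_cases hc : (rot α)^[j] x < 1 - α
  · have hc' : 1 - α ≤ (rot α)^[j] y := by
      by_contra hh
      push Not at hh
      exact h3 ⟨fun _ => hh, fun _ => hc⟩
    refine ⟨?_, by linarith⟩
    by_contra hh
    push Not at hh
    exact core (w := 1 - α - A) hα hx hy j h t ht htj p (by linarith) hh (by linarith)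
  · have hc' : (rot α)^[j] y < 1 - α := by
      by_contra hh
      exact h3 ⟨fun a => absurd a hc, fun a => absurd a hh⟩
    push Not at hc
    refine ⟨by linarith, ?_⟩
    by_contra hh
    push Not at hh
    exact core (w := 1 - α + B) hα hy hx j h' s hs hsj p' (by linarith) (by linarith) hh

lemma disj1 {α A B : ℝ} (hα : α ∈ Set.Ioo (0:ℝ) 1) (s t D L : ℕ)
    (hs : 1 ≤ s) (hsj : s ≤ L) (ht : 1 ≤ t) (htj : t ≤ L) (p p' : ℤ)
    (hA : 0 < A) (hB : 0 < B)
    (ht' : t * α = p - A) (hs' : s * α = p' + B)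
    (hD : ∀ d : ℕ, 0 < d → d < D → ∀ m : ℤ, A + B ≤ |d * α - m|)
    (l₁ l₂ : ℕ) (h1 : L ≤ l₁) (h1' : l₁ < L + D) (h2 : L ≤ l₂) (h2' : l₂ < L + D)
    (hne : l₁ ≠ l₂) : Disjoint (undet α l₁) (undet α l₂) := by
  wlog hlt : l₁ < l₂ generalizing l₁ l₂
  · exact (this l₂ l₁ h2 h2' h1 h1' hne.symm (by omega)).symm
  rw [Set.disjoint_left]
  intro x hx1 hx2
  obtain ⟨M1, a1, b1⟩ := undet_loc hα l₁ s t hs (by omega) ht (by omega) p p' hA hB ht' hs' hx1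
  obtain ⟨M2, a2, b2⟩ := undet_loc hα l₂ s t hs (by omega) ht (by omega) p p' hA hB ht' hs' hx2
  have := hD (l₂ - l₁) (by omega) (by omega) (M2 - M1)
  rw [Nat.cast_sub hlt.le] at this
  push_cast at this
  have h : |((l₂:ℝ) - l₁) * α - (M2 - M1)| < A + B := by
    rw [abs_lt]; constructor <;> nlinarith
  linarith

lemma disj2 {α e f : ℝ} (hα : α ∈ Set.Ioo (0:ℝ) 1) (s t D L : ℕ)
    (hs : 1 ≤ s) (hsj : s ≤ L) (ht : 1 ≤ t) (htj : t ≤ L) (p p' : ℤ) (k : ℕ)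
    (he : 0 < e) (hf : 0 < f)
    (ht' : t * α - p = (-1) ^ (k+1) * e) (hs' : s * α - p' = (-1) ^ k * f)
    (hD : ∀ d : ℕ, 0 < d → d < D → ∀ m : ℤ, e + f ≤ |d * α - m|)
    (l₁ l₂ : ℕ) (h1 : L ≤ l₁) (h1' : l₁ < L + D) (h2 : L ≤ l₂) (h2' : l₂ < L + D)
    (hne : l₁ ≠ l₂) : Disjoint (undet α l₁) (undet α l₂) := by
  rw [pow_succ] at ht'
  rcases neg_one_pow_eq_or ℝ k with h | h <;> rw [h] at ht' hs'
  · exact disj1 hα s t D L hs hsj ht htj p p' he hf (by linarith) (by linarith) hD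
      l₁ l₂ h1 h1' h2 h2' hne
  · exact disj1 hα t s D L ht htj hs hsj p' p hf he (by linarith) (by linarith)
      (fun d a b m => by linarith [hD d a b m])
      l₁ l₂ h1 h1' h2 h2' hne

noncomputable def cfP (α : ℝ) : ℕ → ℤ
  | 0 => 0
  | 1 => 1
  | n + 2 => cfA α (n + 2) * cfP α (n + 1) + cfP α n

noncomputable def cfT (α : ℝ) : ℕ → ℝ
  | 0 => α
  | n + 1 => gaussMap^[n + 1] α * cfT α n

lemma gauss_mem {α : ℝ} (hα : α ∈ Set.Ioo (0:ℝ) 1) (hirr : Irrational α) (n : ℕ) :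
    gaussMap^[n] α ∈ Set.Ioo (0:ℝ) 1 ∧ Irrational (gaussMap^[n] α) := by
  induction n with
  | zero => exact ⟨hα, hirr⟩
  | succ n ih =>
    rw [Function.iterate_succ_apply']
    set g := gaussMap^[n] α
    have h1 : Irrational (gaussMap g) := by
      unfold gaussMap Int.fract
      rw [one_div]
      exact ih.2.inv.sub_intCast _
    refine ⟨⟨lt_of_le_of_ne (Int.fract_nonneg _) ?_, Int.fract_lt_one _⟩, h1⟩
    intro h
    apply h1.ne_zero
    exact h.symm

lemma gauss_eq {α : ℝ} (hα : α ∈ Set.Ioo (0:ℝ) 1) (hirr : Irrational α) (n : ℕ) :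
    gaussMap^[n] α * gaussMap^[n+1] α = 1 - cfA α (n+1) * gaussMap^[n] α := by
  obtain ⟨⟨h0, h1⟩, _⟩ := gauss_mem hα hirr n
  rw [Function.iterate_succ_apply']
  unfold cfA
  rw [Nat.add_sub_cancel]
  set g := gaussMap^[n] α
  have h2 : 0 ≤ 1 / g := by positivity
  unfold gaussMap Int.fract
  rw [natCast_floor_eq_intCast_floor h2]
  field_simp

lemma cfA_pos {α : ℝ} (hα : α ∈ Set.Ioo (0:ℝ) 1) (hirr : Irrational α) (n : ℕ) :
    1 ≤ cfA α (n+1) := by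
  obtain ⟨⟨h0, h1⟩, _⟩ := gauss_mem hα hirr n
  unfold cfA
  rw [Nat.add_sub_cancel, Nat.one_le_floor_iff, le_div_iff₀ h0]
  linarith

lemma cfT_pos {α : ℝ} (hα : α ∈ Set.Ioo (0:ℝ) 1) (hirr : Irrational α) (n : ℕ) :
    0 < cfT α n := by
  induction n with
  | zero => exact hα.1
  | succ n ih => exact mul_pos (gauss_mem hα hirr (n+1)).1.1 ih

lemma cfT_rec {α : ℝ} (hα : α ∈ Set.Ioo (0:ℝ) 1) (hirr : Irrational α) (n : ℕ) :
    cfT α (n+2) = cfT α n - cfA α (n+2) * cfT α (n+1) := by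
  have := gauss_eq hα hirr (n+1)
  change gaussMap^[n+2] α * (gaussMap^[n+1] α * cfT α n) =
    cfT α n - cfA α (n+2) * (gaussMap^[n+1] α * cfT α n)
  linear_combination cfT α n * this

lemma cfQ_pos {α : ℝ} (hα : α ∈ Set.Ioo (0:ℝ) 1) (hirr : Irrational α) (n : ℕ) :
    1 ≤ cfQ α n ∧ cfQ α n ≤ cfQ α (n+1) := by
  induction n with
  | zero => exact ⟨le_rfl, cfA_pos hα hirr 0⟩
  | succ n ih =>
    refine ⟨by omega, ?_⟩
    change _ ≤ cfA α (n + 2) * cfQ α (n + 1) + cfQ α n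
    have := cfA_pos hα hirr (n+1)
    nlinarith [Nat.zero_le (cfQ α n)]

lemma cf_err {α : ℝ} (hα : α ∈ Set.Ioo (0:ℝ) 1) (hirr : Irrational α) (n : ℕ) :
    cfQ α n * α - cfP α n = (-1)^n * cfT α n ∧
    cfQ α (n+1) * α - cfP α (n+1) = (-1)^(n+1) * cfT α (n+1) := by
  induction n with
  | zero =>
    have := gauss_eq hα hirr 0
    simp [cfQ, cfP, cfT] at this ⊢
    linarith
  | succ n ih =>
    refine ⟨ih.2, ?_⟩
    rw [cfT_rec hα hirr, cfQ, cfP]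
    push_cast
    have := ih.1
    have := ih.2
    rw [pow_succ] at *
    linear_combination ih.1 + cfA α (n+2) * ih.2

lemma cf_det (α : ℝ) (n : ℕ) :
    cfP α (n+1) * cfQ α n - cfP α n * cfQ α (n+1) = (-1)^n := by
  induction n with
  | zero => simp [cfP, cfQ]
  | succ n ih =>
    rw [cfQ, cfP]
    push_cast
    rw [pow_succ]
    linear_combination -ih

lemma best {α : ℝ} (hα : α ∈ Set.Ioo (0:ℝ) 1) (hirr : Irrational α) (n d : ℕ)
    (hd : 0 < d) (hd' : d < cfQ α (n+1)) (m : ℤ) : cfT α n ≤ |d * α - m| := by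
  have hdet := cf_det α n
  obtain ⟨e1, e2⟩ := cf_err hα hirr n
  have t1 := cfT_pos hα hirr n
  have t2 := cfT_pos hα hirr (n+1)
  have q1 := (cfQ_pos hα hirr n).1
  have q2 := (cfQ_pos hα hirr (n+1)).1
  obtain ⟨x, y, hx, hy⟩ : ∃ x y : ℤ, (d:ℤ) = x * cfQ α n + y * cfQ α (n+1) ∧
      m = x * cfP α n + y * cfP α (n+1) := by
    refine ⟨(-1)^n * (cfP α (n+1) * d - cfQ α (n+1) * m),
      (-1)^n * (cfQ α n * m - cfP α n * d), ?_, ?_⟩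
    · have h : ((-1:ℤ)^n)*(-1)^n = 1 := by rw [← mul_pow]; simp
      linear_combination (-(d:ℤ)) * h - (d:ℤ) * (-1)^n * hdet
    · have h : ((-1:ℤ)^n)*(-1)^n = 1 := by rw [← mul_pow]; simp
      linear_combination (-m) * h - m * (-1)^n * hdet
  have hxR : (d:ℝ) = x * cfQ α n + y * cfQ α (n+1) := by exact_mod_cast hx
  have hyR : (m:ℝ) = x * cfP α n + y * cfP α (n+1) := by exact_mod_cast hy
  have key : d * α - m = (-1)^n * (x * cfT α n - y * cfT α (n+1)) := by
    rw [hxR, hyR]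
    rw [pow_succ] at e2
    linear_combination x * e1 + y * e2
  rw [key, abs_mul, abs_pow, abs_neg, abs_one, one_pow, one_mul]
  have cases : (1 ≤ x ∧ y ≤ 0) ∨ (x ≤ -1 ∧ 0 ≤ y) := by
    generalize cfQ α n = a at *
    generalize cfQ α (n+1) = b at *
    zify at hd hd' q1 q2
    rcases le_or_gt 1 x with h | h
    · left
      refine ⟨h, ?_⟩
      by_contra hh
      push Not at hh
      nlinarith
    · right
      have hy1 : 0 < y := by
        by_contra hh
        push Not at hh
        nlinarith
      refine ⟨?_, hy1.le⟩
      by_contra hh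
      have : x = 0 := by omega
      subst this
      nlinarith
  rcases cases with ⟨a, b⟩ | ⟨a, b⟩
  · have a' : (1:ℝ) ≤ x := by exact_mod_cast a
    have b' : (y:ℝ) ≤ 0 := by exact_mod_cast b
    refine le_trans ?_ (le_abs_self _)
    nlinarith
  · have a' : (x:ℝ) ≤ -1 := by exact_mod_cast a
    have b' : (0:ℝ) ≤ y := by exact_mod_cast b
    refine le_trans ?_ (neg_le_abs _)
    nlinarith

theorem stmt14 (α : ℝ) (hα : α ∈ Set.Ioo (0:ℝ) 1) (hirr : Irrational α)
    (i : ℕ) (hi : 1 ≤ i) :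
    (∀ l₁ l₂ : ℕ, cfQ α i ≤ l₁ → l₁ < cfQ α (i - 1) + cfQ α i →
      cfQ α i ≤ l₂ → l₂ < cfQ α (i - 1) + cfQ α i → l₁ ≠ l₂ →
      Disjoint (undet α l₁) (undet α l₂)) ∧
    (∀ b : ℕ, 2 ≤ b → b ≤ cfA α (i + 1) →
      ∀ l₁ l₂ : ℕ, cfQ α (i - 1) + (b - 1) * cfQ α i ≤ l₁ →
        l₁ < cfQ α (i - 1) + b * cfQ α i →
        cfQ α (i - 1) + (b - 1) * cfQ α i ≤ l₂ →
        l₂ < cfQ α (i - 1) + b * cfQ α i → l₁ ≠ l₂ →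
        Disjoint (undet α l₁) (undet α l₂)) := by
  obtain ⟨n, rfl⟩ : ∃ n, i = n + 1 := ⟨i - 1, by omega⟩
  rw [Nat.add_sub_cancel]
  obtain ⟨e1, e2⟩ := cf_err hα hirr n
  have t1 := cfT_pos hα hirr n
  have t2 := cfT_pos hα hirr (n+1)
  have t3 := cfT_pos hα hirr (n+2)
  have r := cfT_rec hα hirr n
  have q1 := cfQ_pos hα hirr n
  have q2 := (cfQ_pos hα hirr (n+1)).1
  constructor
  · intro l₁ l₂ h1 h1' h2 h2' hne
    refine disj2 hα (cfQ α n) (cfQ α (n+1)) (cfQ α n) (cfQ α (n+1)) q1.1 q1.2 q2 le_rfl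
      (cfP α (n+1)) (cfP α n) n t2 t1 e2 e1 ?_ l₁ l₂ h1 (by omega) h2 (by omega) hne
    intro d hd hd' m
    cases n with
    | zero => rw [cfQ] at hd'; omega
    | succ k =>
      refine le_trans ?_ (best hα hirr k d hd hd' m)
      have r' := cfT_rec hα hirr k
      have a : (1:ℝ) ≤ cfA α (k+2) := by exact_mod_cast cfA_pos hα hirr (k+1)
      nlinarith
  · intro b hb hb' l₁ l₂ h1 h1' h2 h2' hne
    obtain ⟨c, rfl⟩ : ∃ c, b = c + 1 := ⟨b - 1, by omega⟩
    rw [Nat.add_sub_cancel] at h1 h2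
    have hE : cfQ α n + (c+1) * cfQ α (n+1) = cfQ α n + c * cfQ α (n+1) + cfQ α (n+1) := by ring
    rw [hE] at h1' h2'
    have c1 : (1:ℝ) ≤ c := by exact_mod_cast (by omega : 1 ≤ c)
    have c2 : (c:ℝ) + 1 ≤ cfA α (n+2) := by exact_mod_cast hb'
    have hc : 1 ≤ c := by omega
    refine disj2 hα (cfQ α n + c * cfQ α (n+1)) (cfQ α (n+1)) (cfQ α (n+1))
      (cfQ α n + c * cfQ α (n+1)) (by omega) le_rfl q2 (by nlinarith)
      (cfP α (n+1)) (cfP α n + c * cfP α (n+1)) n (e := cfT α (n+1))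
      (f := cfT α n - c * cfT α (n+1)) t2 (by nlinarith) e2 ?_ ?_ l₁ l₂ h1 h1' h2 h2' hne
    · push_cast
      rw [pow_succ] at e2
      linear_combination e1 + c * e2
    · intro d hd hd' m
      refine le_trans ?_ (best hα hirr n d hd hd' m)
      nlinarith
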